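/- Let d be a positive integer, N ≥ 2, and τ > 0. Consider the problem of minimizing ‖C‖₁ over all pairs (Z, C) with Z ∈ ℝ^{d×N}, C ∈ ℝ^{N×N}, subject to: all diagonal entries of C are zero, Z = ZC, and every column Z_i of Z has squared Euclidean norm ‖Z_i‖² = τ. The optimal value is N, and every optimal pair (Z*, C*) satisfies: (i) for every index i there exists an index j ≠ i and a sign s_{i,j} ∈ {−1, 1} with Z*_i = s_{i,j}·Z*_j; (ii) every column of C* has ℓ1 norm ‖C*_i‖₁ = 1; and (iii) C*_{i,j} ≠ 0 implies Z*_i = Z*_j or Z*_i = −Z*_j. -/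

import Mathlib

open Matrix

/-- Entrywise ℓ1 norm of a matrix. -/
noncomputable def l1 {m n : ℕ} (A : Matrix (Fin m) (Fin n) ℝ) : ℝ :=
  ∑ i, ∑ j, |A i j|

section SelfExpression

variable {ι κ : Type*} [Fintype ι] [Fintype κ]

/-- Vectors of equal squared norm whose inner product equals that squared norm coincide. -/
lemma eq_of_dotProduct_eq_sq_norm {τ : ℝ} {x y : κ → ℝ} (hx : ∑ k, x k ^ 2 = τ)
    (hy : ∑ k, y k ^ 2 = τ) (hxy : ∑ k, x k * y k = τ) (k : κ) : x k = y k := by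
  have hsum : ∑ k, (x k - y k) ^ 2 = 0 := by
    have hexp : ∑ k, (x k - y k) ^ 2
        = ∑ k, x k ^ 2 - 2 * ∑ k, x k * y k + ∑ k, y k ^ 2 := by
      rw [Finset.mul_sum, ← Finset.sum_sub_distrib, ← Finset.sum_add_distrib]
      exact Finset.sum_congr rfl fun k _ => by ring
    rw [hexp, hx, hy, hxy]
    ring
  have hk := (Finset.sum_eq_zero_iff_of_nonneg fun k _ => sq_nonneg (x k - y k)).1 hsum k
    (Finset.mem_univ k)
  exact sub_eq_zero.1 (pow_eq_zero_iff two_ne_zero |>.1 hk)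

lemma abs_dotProduct_le_of_sq_norm_eq {τ : ℝ} {x y : κ → ℝ} (hx : ∑ k, x k ^ 2 = τ)
    (hy : ∑ k, y k ^ 2 = τ) : |∑ k, x k * y k| ≤ τ := by
  have hτ : 0 ≤ τ := hx ▸ Finset.sum_nonneg fun k _ => sq_nonneg (x k)
  refine abs_le_of_sq_le_sq ?_ hτ
  calc (∑ k, x k * y k) ^ 2 ≤ (∑ k, x k ^ 2) * ∑ k, y k ^ 2 :=
        Finset.sum_mul_sq_le_sq_mul_sq _ _ _
    _ = τ ^ 2 := by rw [hx, hy, sq]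

/-- Taking the inner product of the self-expression `Z i = ∑ j, C j i • Z j` with `Z i`. -/
lemma sum_mul_dotProduct_eq_of_self_expression {τ : ℝ} {Z : Matrix κ ι ℝ} {C : Matrix ι ι ℝ}
    (hZC : Z = Z * C) (hZ : ∀ i, ∑ k, Z k i ^ 2 = τ) (i : ι) :
    ∑ j, C j i * ∑ k, Z k j * Z k i = τ := by
  have hcol : ∀ k, Z k i = ∑ j, Z k j * C j i := fun k => by
    conv_lhs => rw [hZC]
    exact Matrix.mul_apply
  calc ∑ j, C j i * ∑ k, Z k j * Z k i = ∑ k, (∑ j, Z k j * C j i) * Z k i := by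
        simp_rw [Finset.mul_sum, Finset.sum_mul]
        rw [Finset.sum_comm]
        exact Finset.sum_congr rfl fun k _ => Finset.sum_congr rfl fun j _ => by ring
    _ = ∑ k, Z k i ^ 2 := Finset.sum_congr rfl fun k _ => by rw [← hcol k, sq]
    _ = τ := hZ i

lemma mul_dotProduct_le_abs_mul {τ : ℝ} {x y : κ → ℝ} (hx : ∑ k, x k ^ 2 = τ)
    (hy : ∑ k, y k ^ 2 = τ) (c : ℝ) : c * ∑ k, x k * y k ≤ |c| * τ :=
  calc c * ∑ k, x k * y k ≤ |c| * |∑ k, x k * y k| := by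
        rw [← abs_mul]
        exact le_abs_self _
    _ ≤ |c| * τ :=
        mul_le_mul_of_nonneg_left (abs_dotProduct_le_of_sq_norm_eq hx hy) (abs_nonneg c)

lemma one_le_sum_abs_of_self_expression {τ : ℝ} (hτ : 0 < τ) {Z : Matrix κ ι ℝ}
    {C : Matrix ι ι ℝ} (hZC : Z = Z * C) (hZ : ∀ i, ∑ k, Z k i ^ 2 = τ) (i : ι) :
    1 ≤ ∑ j, |C j i| := by
  refine le_of_mul_le_mul_right ?_ hτ
  calc 1 * τ = ∑ j, C j i * ∑ k, Z k j * Z k i := by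
        rw [one_mul, sum_mul_dotProduct_eq_of_self_expression hZC hZ]
    _ ≤ ∑ j, |C j i| * τ := Finset.sum_le_sum fun j _ => mul_dotProduct_le_abs_mul (hZ j) (hZ i) _
    _ = (∑ j, |C j i|) * τ := (Finset.sum_mul ..).symm

/-- A column of `C` of minimal ℓ1 norm is supported on signed duplicates. -/
lemma eq_or_eq_neg_of_sum_abs_eq_one {τ : ℝ} {Z : Matrix κ ι ℝ}
    {C : Matrix ι ι ℝ} (hZC : Z = Z * C) (hZ : ∀ i, ∑ k, Z k i ^ 2 = τ) {i j : ι}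
    (hC : ∑ l, |C l i| = 1) (hji : C j i ≠ 0) :
    (∀ k, Z k j = Z k i) ∨ ∀ k, Z k j = -Z k i := by
  have hsum : ∑ l, C l i * ∑ k, Z k l * Z k i = ∑ l, |C l i| * τ := by
    rw [sum_mul_dotProduct_eq_of_self_expression hZC hZ, ← Finset.sum_mul, hC, one_mul]
  have hj := (Finset.sum_eq_sum_iff_of_le
    fun l _ => mul_dotProduct_le_abs_mul (hZ l) (hZ i) (C l i)).1 hsum j (Finset.mem_univ j)
  rcases lt_or_gt_of_ne hji with hneg | hpos
  · right
    rw [abs_of_neg hneg, neg_mul, ← mul_neg] at hj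
    refine eq_of_dotProduct_eq_sq_norm (y := fun k => -Z k i) (hZ j) (by simpa using hZ i) ?_
    simp only [mul_neg, Finset.sum_neg_distrib]
    rw [mul_left_cancel₀ hji hj, neg_neg]
  · left
    rw [abs_of_pos hpos] at hj
    exact eq_of_dotProduct_eq_sq_norm (hZ j) (hZ i) (mul_left_cancel₀ hji hj)

end SelfExpression

lemma l1_eq_sum_columns {m n : ℕ} (A : Matrix (Fin m) (Fin n) ℝ) :
    l1 A = ∑ j, ∑ i, |A i j| :=
  Finset.sum_comm

/-- A feasible pair of objective value `N`: all columns of `Z` are equal, and `C` selects for each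
column some other one. -/
lemma exists_self_expression_l1_eq {d N : ℕ} (hd : 0 < d) (hN : 2 ≤ N) {τ : ℝ} (hτ : 0 ≤ τ) :
    ∃ (Z : Matrix (Fin d) (Fin N) ℝ) (C : Matrix (Fin N) (Fin N) ℝ),
      (∀ i, C i i = 0) ∧ Z = Z * C ∧ (∀ i, (∑ k, Z k i ^ 2) = τ) ∧ (N : ℝ) = l1 C := by
  have : Nontrivial (Fin N) := Fin.nontrivial_iff_two_le.2 hN
  choose σ hσ using fun j : Fin N => exists_ne j
  refine ⟨.of fun k _ => if k = ⟨0, hd⟩ then √τ else 0,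
    .of fun i j => if i = σ j then 1 else 0, fun i => if_neg (hσ i).symm, ?_, fun i => ?_, ?_⟩
  · ext k i
    simp [Matrix.mul_apply]
  · simp [ite_pow, Real.sq_sqrt hτ]
  · simp [l1_eq_sum_columns, apply_ite abs]

theorem stmt16 (d N : ℕ) (hd : 0 < d) (hN : 2 ≤ N) (τ : ℝ) (hτ : 0 < τ) :
    IsLeast {y : ℝ | ∃ (Z : Matrix (Fin d) (Fin N) ℝ) (C : Matrix (Fin N) (Fin N) ℝ),
        (∀ i, C i i = 0) ∧ Z = Z * C ∧ (∀ i, (∑ k, Z k i ^ 2) = τ) ∧ y = l1 C} (N : ℝ) ∧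
    ∀ (Z : Matrix (Fin d) (Fin N) ℝ) (C : Matrix (Fin N) (Fin N) ℝ),
      (∀ i, C i i = 0) → Z = Z * C → (∀ i, (∑ k, Z k i ^ 2) = τ) → l1 C = N →
      ((∀ i, ∃ j, j ≠ i ∧ ∃ s : ℝ, (s = 1 ∨ s = -1) ∧ ∀ k, Z k i = s * Z k j) ∧
       (∀ i, (∑ j, |C j i|) = 1) ∧
       (∀ i j, C i j ≠ 0 → ((∀ k, Z k i = Z k j) ∨ (∀ k, Z k i = - Z k j)))) := by
  have hfeas := fun (Z : Matrix (Fin d) (Fin N) ℝ) (C : Matrix (Fin N) (Fin N) ℝ)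
    (hZC : Z = Z * C) (hZ : ∀ i, (∑ k, Z k i ^ 2) = τ) =>
    one_le_sum_abs_of_self_expression hτ hZC hZ
  have hcard : ∑ _j : Fin N, (1 : ℝ) = N := by simp
  refine ⟨⟨exists_self_expression_l1_eq hd hN hτ.le, ?_⟩, fun Z C hdiag hZC hZ hopt => ?_⟩
  · rintro y ⟨Z, C, -, hZC, hZ, rfl⟩
    rw [l1_eq_sum_columns, ← hcard]
    exact Finset.sum_le_sum fun j _ => hfeas Z C hZC hZ j
  · rw [l1_eq_sum_columns, ← hcard] at hopt
    have hcol : ∀ i, ∑ j, |C j i| = 1 := fun i =>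
      ((Finset.sum_eq_sum_iff_of_le fun j _ => hfeas Z C hZC hZ j).1 hopt.symm i
        (Finset.mem_univ i)).symm
    have hdup := fun i j => eq_or_eq_neg_of_sum_abs_eq_one hZC hZ (j := i) (hcol j)
    refine ⟨fun i => ?_, hcol, hdup⟩
    obtain ⟨j, -, hj⟩ := Finset.exists_ne_zero_of_sum_ne_zero
      ((hcol i).trans_ne one_ne_zero)
    have hji : C j i ≠ 0 := abs_ne_zero.1 hj
    refine ⟨j, fun h => hji (h ▸ hdiag i), ?_⟩
    rcases hdup j i hji with h | h
    · exact ⟨1, Or.inl rfl, fun k => by rw [h k, one_mul]⟩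
    · exact ⟨-1, Or.inr rfl, fun k => by rw [h k, neg_one_mul, neg_neg]⟩
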